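/- The column of the adjugate of Q_P with index b−1 has the following form: for every row index k with k < n − b, the entry adjugate(Q_P) k (b−1) equals the minor μ(b−1, k) and has total degree exactly n − b; the entry adjugate(Q_P) (n−b) (b−1) equals det Q₃; and adjugate(Q_P) k (b−1) = 0 for every k with n − b < k < n. -/

import Mathlib

open MvPolynomial Matrix

noncomputable section

/-- The scalar sequence `u`: first `n = m*b` values are `0,…,0,1`, then it follows the
linear recurrence with coefficients `c`. -/
def uSeq (m b : ℕ) (c : Fin (m*b) → ZMod 2) : ℕ → ZMod 2
  | s =>
    if s < m*b then (if s = m*b - 1 then 1 else 0)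
    else ∑ j : Fin (m*b), c j * uSeq m b c (s - m*b + j)
  termination_by s => s
  decreasing_by have := j.isLt; omega

/-- The symbolic sequence `w t`: first `n = m*b` values are the indeterminates `X (t, s)`,
then it follows the linear recurrence with coefficients `c`. -/
def wPoly (m b : ℕ) (c : Fin (m*b) → ZMod 2) (t : Fin (m-1)) :
    ℕ → MvPolynomial ((Fin (m-1)) × ℕ) (ZMod 2)
  | s =>
    if s < m*b then X (t, s)
    else ∑ j : Fin (m*b), C (c j) * wPoly m b c t (s - m*b + j)
  termination_by s => s
  decreasing_by have := j.isLt; omega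

/-- The matrix `Q_P` of Equation (13). -/
def QP (m b : ℕ) (hm : 2 ≤ m) (hb : 1 ≤ b) (c : Fin (m*b) → ZMod 2) :
    Matrix (Fin (m*b)) (Fin (m*b)) (MvPolynomial ((Fin (m-1)) × ℕ) (ZMod 2)) :=
  fun i j =>
    if (i : ℕ) < b then C (uSeq m b c ((i : ℕ) + (j : ℕ)))
    else wPoly m b c
      ⟨((i : ℕ) - b) / b, by
        have hi := i.isLt
        have h2 : 2 * b ≤ m * b := Nat.mul_le_mul hm (le_refl b)
        have h1 : b * (m - 1) = m * b - b := by
          cases m with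
          | zero => simp
          | succ m' => simp [Nat.succ_mul, Nat.mul_comm]
        have : (i : ℕ) - b < b * (m - 1) := by omega
        exact Nat.div_lt_of_lt_mul this⟩
      (((i : ℕ) - b) % b + (j : ℕ))

/-- The map from `Fin (n-1)` to `Fin n` skipping the index `i`. -/
def skipIdx {n : ℕ} (i : Fin n) (k : Fin (n - 1)) : Fin n :=
  if (k : ℕ) < (i : ℕ) then ⟨k, by have := k.isLt; have := i.isLt; omega⟩
  else ⟨(k : ℕ) + 1, by have := k.isLt; have := i.isLt; omega⟩

/-- The minor `μ(i,j)`: determinant of the matrix obtained by deleting row `i` and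
column `j`. -/
def minorQ {n : ℕ} {R : Type*} [CommRing R] (A : Matrix (Fin n) (Fin n) R) (i j : Fin n) : R :=
  (A.submatrix (skipIdx i) (skipIdx j)).det

/-- The bottom-left block `Q₃` of `Q_P`: rows `b,…,n-1` and columns `0,…,n-b-1`. -/
def Q3 (m b : ℕ) (hm : 2 ≤ m) (hb : 1 ≤ b) (c : Fin (m*b) → ZMod 2) :
    Matrix (Fin (m*b - b)) (Fin (m*b - b)) (MvPolynomial ((Fin (m-1)) × ℕ) (ZMod 2)) :=
  fun i j =>
    QP m b hm hb c
      ⟨b + (i : ℕ), by have := i.isLt; omega⟩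
      ⟨(j : ℕ), by have := j.isLt; omega⟩

end

open Finset

/-- In a commutative ring of characteristic two, every integer unit casts to `1`. -/
lemma intUnit_cast_eq_one_of_charTwo {R : Type*} [CommRing R] [CharP R 2] (s : ℤˣ) :
    ((s : ℤ) : R) = 1 := by
  rcases Int.units_eq_one_or s with rfl | rfl
  · simp
  · simp [CharTwo.neg_eq]

/-- In characteristic two, reindexing rows and columns independently preserves determinants. -/
lemma det_submatrix_equiv_equiv_of_charTwo {R ι κ : Type*} [CommRing R] [CharP R 2]
    [Fintype ι] [DecidableEq ι] [Fintype κ] [DecidableEq κ]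
    (A : Matrix ι ι R) (e f : κ ≃ ι) : (A.submatrix e f).det = A.det := by
  have h : A.submatrix e f = (A.submatrix (f.symm.trans e) id).submatrix f f := by
    ext i j
    simp
  rw [h, det_submatrix_equiv_self]
  exact (det_permute _ A).trans (by rw [intUnit_cast_eq_one_of_charTwo, one_mul])

lemma skipIdx_val {n : ℕ} (i : Fin n) (k : Fin (n - 1)) :
    (skipIdx i k : ℕ) = if (k : ℕ) < i then (k : ℕ) else k + 1 := by
  unfold skipIdx
  split_ifs <;> rfl

lemma skipIdx_eq_succAbove {n : ℕ} (i : Fin (n + 1)) :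
    (skipIdx i : Fin n → Fin (n + 1)) = i.succAbove := by
  funext k
  apply Fin.ext
  have h := skipIdx_val i k
  rw [h, Fin.succAbove]
  simp only [Fin.lt_def, Fin.val_castSucc]
  split_ifs <;> simp

/-- In characteristic two, adjugate entries are minors without sign. -/
lemma adjugate_eq_minorQ_of_charTwo {R : Type*} [CommRing R] [CharP R 2] {n : ℕ}
    (A : Matrix (Fin n) (Fin n) R) (i j : Fin n) : A.adjugate i j = minorQ A j i := by
  cases n with
  | zero => exact i.elim0
  | succ n =>
    rw [adjugate_fin_succ_eq_det_submatrix, CharTwo.neg_eq, one_pow, one_mul,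
      ← skipIdx_eq_succAbove, ← skipIdx_eq_succAbove]
    rfl

/-- A determinant vanishes if a set of rows is supported on a strictly smaller set of columns. -/
lemma det_eq_zero_of_card_lt {R ι : Type*} [CommRing R] [Fintype ι] [DecidableEq ι]
    (A : Matrix ι ι R) (rows cols : Finset ι) (hcard : #cols < #rows)
    (hA : ∀ i ∈ rows, ∀ j ∉ cols, A i j = 0) : A.det = 0 := by
  rw [← det_transpose, det_apply]
  refine sum_eq_zero fun σ _ => ?_
  obtain ⟨i, hi, hσ⟩ : ∃ i ∈ rows, σ i ∉ cols := by
    by_contra! h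
    exact hcard.not_ge (card_le_card_of_injOn σ h σ.injective.injOn)
  have hprod : ∏ i, Aᵀ (σ i) i = 0 := prod_eq_zero (mem_univ i) (hA i hi _ hσ)
  rw [hprod, smul_zero]

/-- If the identity and `σ` select the same variables from a stack of Hankel rows, then `σ` is
the identity. -/
lemma perm_eq_one_of_sum_single_eq {τ : Type*} {p : ℕ} {t : Fin p → τ} {r g : Fin p → ℕ}
    (hr : ∀ i j, i < j → t i = t j → r i < r j) (hg : StrictMono g) {σ : Equiv.Perm (Fin p)}
    (h : ∑ i, Finsupp.single (t i, r i + g (σ i)) 1 = ∑ i, Finsupp.single (t i, r i + g i) 1) :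
    σ = 1 := by
  suffices key : ∀ N : ℕ, ∀ i : Fin p, (i : ℕ) = N → σ i = i from
    Equiv.ext fun i => key i i rfl
  intro N
  induction N using Nat.strong_induction_on with
  | _ N ih =>
    intro i hi
    have fixed : ∀ j < i, σ j = j := fun j hj => ih j (hi ▸ hj) j rfl
    obtain ⟨j, hj⟩ : ∃ j, (t j, r j + g (σ j)) = (t i, r i + g i) := by
      by_contra! hne
      have hcount := DFunLike.congr_fun h (t i, r i + g i)
      rw [Finsupp.finsetSum_apply, Finsupp.finsetSum_apply,
        sum_eq_zero fun j _ => Finsupp.single_eq_of_ne (hne j).symm] at hcount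
      have hle := single_le_sum
        (f := fun j => (Finsupp.single (t j, r j + g j) 1 : _ →₀ ℕ) (t i, r i + g i))
        (fun _ _ => Nat.zero_le _) (mem_univ i)
      simp only [Finsupp.single_eq_same] at hle
      omega
    obtain ⟨ht, hsum⟩ := Prod.mk.inj hj
    rcases lt_trichotomy j i with hji | rfl | hij
    · have := hr j i hji ht
      have := hg hji
      rw [fixed j hji] at hsum
      omega
    · exact hg.injective (by omega)
    · have := hr i j hij ht.symm
      have hlt : σ j < i := hg.lt_iff_lt.mp (by omega)
      have := σ.injective (fixed _ hlt)
      exact absurd (this ▸ hlt) hij.not_gt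

/-- The determinant of a square selection of columns from a stack of generic Hankel blocks has
total degree equal to its size; in particular it does not vanish. -/
lemma totalDegree_det_generic_hankel {K τ : Type*} [CommRing K] [Nontrivial K] {p : ℕ}
    {t : Fin p → τ} {r g : Fin p → ℕ}
    (hr : ∀ i j, i < j → t i = t j → r i < r j) (hg : StrictMono g) :
    (Matrix.of fun i j : Fin p => (X (t i, r i + g j) : MvPolynomial (τ × ℕ) K)).det.totalDegree
      = p := by
  classical
  rw [← det_transpose, det_apply']
  simp only [transpose_apply, of_apply]
  refine IsHomogeneous.totalDegree (IsHomogeneous.sum _ _ _ fun σ _ => ?_) fun hzero => ?_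
  · have hprod := IsHomogeneous.prod univ
      (fun i => (X (t i, r i + g (σ i)) : MvPolynomial (τ × ℕ) K)) (fun _ => 1)
      fun i _ => isHomogeneous_X K _
    rw [sum_const, card_univ, Fintype.card_fin, smul_eq_mul, mul_one] at hprod
    simpa using (isHomogeneous_C (τ × ℕ) (((Equiv.Perm.sign σ : ℤˣ) : ℤ) : K)).mul hprod
  · have hmon : ∀ σ : Equiv.Perm (Fin p),
        (∏ i, (X (t i, r i + g (σ i)) : MvPolynomial (τ × ℕ) K))
          = monomial (∑ i, Finsupp.single (t i, r i + g (σ i)) 1) 1 := fun σ => by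
      rw [monomial_sum_one]
      rfl
    have hcoeff := congrArg (coeff (∑ i, Finsupp.single (t i, r i + g i) 1)) hzero
    rw [coeff_sum, sum_eq_single 1, hmon] at hcoeff
    · simp at hcoeff
    · intro σ _ hσ
      rw [hmon, ← map_intCast (C : K →+* MvPolynomial (τ × ℕ) K), coeff_C_mul, coeff_monomial,
        if_neg fun h => hσ (perm_eq_one_of_sum_single_eq hr hg h), mul_zero]
    · simp

lemma uSeq_eq_zero {m b : ℕ} (c : Fin (m*b) → ZMod 2) {s : ℕ} (hs : s + 1 < m*b) :
    uSeq m b c s = 0 := by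
  rw [uSeq, if_pos (by omega), if_neg (by omega)]

lemma uSeq_eq_one {m b : ℕ} (c : Fin (m*b) → ZMod 2) {s : ℕ} (hs : s + 1 = m*b) :
    uSeq m b c s = 1 := by
  rw [uSeq, if_pos (by omega), if_pos (by omega)]

lemma QP_eq_zero {m b : ℕ} (hm : 2 ≤ m) (hb : 1 ≤ b) (c : Fin (m*b) → ZMod 2)
    {i j : Fin (m*b)} (hi : (i : ℕ) < b) (hij : (i : ℕ) + j + 1 < m*b) :
    QP m b hm hb c i j = 0 := by
  rw [QP, if_pos hi, uSeq_eq_zero c hij, C_0]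

lemma QP_eq_one {m b : ℕ} (hm : 2 ≤ m) (hb : 1 ≤ b) (c : Fin (m*b) → ZMod 2)
    {i j : Fin (m*b)} (hi : (i : ℕ) < b) (hij : (i : ℕ) + j + 1 = m*b) :
    QP m b hm hb c i j = 1 := by
  rw [QP, if_pos hi, uSeq_eq_one c hij, C_1]

/-- For `k ≤ n - b`, entry `(k, b - 1)` of the adjugate of `Q_P` is the determinant of the last
`n - b` rows on the first `n - b + 1` columns with column `k` deleted. -/
lemma adjugate_QP_eq_det {m b : ℕ} (hm : 2 ≤ m) (hb : 1 ≤ b) (c : Fin (m*b) → ZMod 2)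
    (k l : Fin (m*b)) (hk : (k : ℕ) ≤ m*b - b) (hl : (l : ℕ) = b - 1)
    (rows cols : Fin (m*b - b) → Fin (m*b)) (hrows : ∀ i, (rows i : ℕ) = b + i)
    (hcols : ∀ j, (cols j : ℕ) = if (j : ℕ) < k then (j : ℕ) else j + 1) :
    (QP m b hm hb c).adjugate k l = ((QP m b hm hb c).submatrix rows cols).det := by
  have hn : 2 * b ≤ m * b := Nat.mul_le_mul_right b hm
  have hcard : Fintype.card (Fin b ⊕ Fin (m*b - b)) = Fintype.card (Fin (m*b)) := by
    simp only [Fintype.card_sum, Fintype.card_fin]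
    omega
  let topRows : Fin b → Fin (m*b) := fun i => ⟨i, by omega⟩
  let topCols : Fin b → Fin (m*b) := fun i =>
    if (i : ℕ) = b - 1 then k else ⟨m*b - 1 - i, by omega⟩
  have htopCols : ∀ i, (topCols i : ℕ) = if (i : ℕ) = b - 1 then (k : ℕ) else m*b - 1 - i := by
    intro i
    dsimp only [topCols]
    split_ifs <;> rfl
  have hcols_ne : ∀ j, cols j ≠ k := fun j h => by
    have := hcols j
    rw [h] at this
    split_ifs at this <;> omega
  have hrowInj : Function.Injective (Sum.elim topRows rows) := by
    refine Function.Injective.sumElim (fun i j h => ?_) (fun i j h => ?_) fun i j h => ?_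
    · simpa [topRows, Fin.ext_iff] using h
    · have := congrArg Fin.val h
      rw [hrows, hrows] at this
      omega
    · have := congrArg Fin.val h
      rw [hrows] at this
      simp only [topRows] at this
      omega
  have hcolInj : Function.Injective (Sum.elim topCols cols) := by
    refine Function.Injective.sumElim (fun i j h => ?_) (fun i j h => ?_) fun i j h => ?_
    · have := congrArg Fin.val h
      rw [htopCols, htopCols] at this
      split_ifs at this <;> omega
    · have := congrArg Fin.val h
      rw [hcols, hcols] at this
      split_ifs at this <;> omega
    · have := congrArg Fin.val h
      rw [htopCols, hcols] at this
      split_ifs at this <;> omega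
  let e := Equiv.ofBijective _ ((Fintype.bijective_iff_injective_and_card _).mpr ⟨hrowInj, hcard⟩)
  let f := Equiv.ofBijective _ ((Fintype.bijective_iff_injective_and_card _).mpr ⟨hcolInj, hcard⟩)
  set A := (QP m b hm hb c).updateRow l (Pi.single k 1) with hA
  have hblocks : A.submatrix e f = fromBlocks (A.submatrix topRows topCols) 0
      (A.submatrix rows topCols) (A.submatrix rows cols) := by
    ext1 i j
    rcases i with i | i <;> rcases j with j | j
    · rfl
    · change A (topRows i) (cols j) = 0
      by_cases hi : topRows i = l
      · rw [hA, hi, updateRow_self, Pi.single_eq_of_ne (hcols_ne j)]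
      · rw [hA, updateRow_ne hi]
        have hil : (i : ℕ) ≠ l := fun h => hi (Fin.ext h)
        refine QP_eq_zero hm hb c i.isLt ?_
        rw [hcols]
        change (i : ℕ) + _ + 1 < _
        split_ifs <;> omega
    · rfl
    · rfl
  have htri : (A.submatrix topRows topCols).det = 1 := by
    rw [det_of_isLowerTriangular]
    · refine prod_eq_one fun i _ => ?_
      rw [submatrix_apply]
      by_cases hi : topRows i = l
      · have hil : (i : ℕ) = b - 1 := hl ▸ congrArg Fin.val hi
        have : topCols i = k := if_pos hil
        rw [hA, hi, updateRow_self, this, Pi.single_eq_same]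
      · rw [hA, updateRow_ne hi]
        have hil : (i : ℕ) ≠ l := fun h => hi (Fin.ext h)
        refine QP_eq_one hm hb c i.isLt ?_
        rw [htopCols, if_neg (by omega)]
        change (i : ℕ) + _ + 1 = _
        omega
    · intro i j hij
      have hij : (i : ℕ) < j := hij
      have hi : topRows i ≠ l := fun h => by
        have : (i : ℕ) = l := congrArg Fin.val h
        omega
      rw [submatrix_apply, hA, updateRow_ne hi]
      refine QP_eq_zero hm hb c i.isLt ?_
      rw [htopCols]
      change (i : ℕ) + _ + 1 < _
      split_ifs <;> omega
  have hbottom : A.submatrix rows cols = (QP m b hm hb c).submatrix rows cols := by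
    ext1 i j
    have hi : rows i ≠ l := fun h => by
      have := hrows i
      rw [h] at this
      omega
    rw [submatrix_apply, hA, updateRow_ne hi, submatrix_apply]
  rw [adjugate_apply, ← hA, ← det_submatrix_equiv_equiv_of_charTwo A e f, hblocks,
    det_fromBlocks_zero₁₂, htri, one_mul, hbottom]

/-- For `k < n - b`, entry `(k, b - 1)` of the adjugate of `Q_P` has total degree `n - b`. -/
lemma totalDegree_adjugate_QP {m b : ℕ} (hm : 2 ≤ m) (hb : 1 ≤ b) (c : Fin (m*b) → ZMod 2)
    (k l : Fin (m*b)) (hk : (k : ℕ) < m*b - b) (hl : (l : ℕ) = b - 1) :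
    ((QP m b hm hb c).adjugate k l).totalDegree = m*b - b := by
  have hn : m * b - b = (m - 1) * b := by rw [Nat.sub_mul, one_mul]
  let g : Fin (m*b - b) → ℕ := fun j => if (j : ℕ) < k then (j : ℕ) else j + 1
  have hgle : ∀ j, g j ≤ m*b - b := fun j => by
    dsimp only [g]
    split_ifs <;> omega
  have hg : StrictMono g := fun i j hij => by
    have : (i : ℕ) < j := hij
    dsimp only [g]
    split_ifs <;> omega
  let t : Fin (m*b - b) → Fin (m - 1) := fun i =>
    ⟨i / b, Nat.div_lt_of_lt_mul (i.isLt.trans_eq (hn.trans (mul_comm _ _)))⟩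
  have hr : ∀ i j : Fin (m*b - b), i < j → t i = t j → (i : ℕ) % b < (j : ℕ) % b := by
    intro i j hij hdiv
    have hij : (i : ℕ) < j := hij
    have hdiv : (i : ℕ) / b = (j : ℕ) / b := congrArg Fin.val hdiv
    have hi := Nat.div_add_mod i b
    have hj := Nat.div_add_mod j b
    rw [hdiv] at hi
    omega
  rw [adjugate_QP_eq_det hm hb c k l hk.le hl (fun i => ⟨b + i, by omega⟩)
    (fun j => ⟨g j, by have := hgle j; omega⟩) (fun _ => rfl) fun _ => rfl]
  refine Eq.trans ?_ (totalDegree_det_generic_hankel (K := ZMod 2) hr hg)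
  refine congrArg (fun M : Matrix _ _ (MvPolynomial _ (ZMod 2)) => M.det.totalDegree) ?_
  ext1 i j
  have hlt : (i : ℕ) % b + g j < m*b := by
    have := hgle j
    have := Nat.mod_lt (i : ℕ) hb
    omega
  simp only [submatrix_apply, QP, of_apply, add_lt_iff_neg_left, not_lt_zero, if_false,
    Nat.add_sub_cancel_left]
  rw [wPoly, if_pos hlt]

/-- For `k > n - b`, entry `(k, b - 1)` of the adjugate of `Q_P` vanishes. -/
lemma adjugate_QP_eq_zero {m b : ℕ} (hm : 2 ≤ m) (hb : 1 ≤ b) (c : Fin (m*b) → ZMod 2)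
    (k l : Fin (m*b)) (hk : m*b - b < (k : ℕ)) (hl : (l : ℕ) = b - 1) :
    (QP m b hm hb c).adjugate k l = 0 := by
  have hn : 2 * b ≤ m * b := Nat.mul_le_mul_right b hm
  rw [adjugate_apply]
  refine det_eq_zero_of_card_lt _ (Iic l) (Ioi ⟨m*b - b, by omega⟩) ?_ fun i hi j hj => ?_
  · rw [Fin.card_Ioi, Fin.card_Iic]
    dsimp only
    omega
  · have hil : i ≤ l := mem_Iic.mp hi
    rw [Fin.le_def] at hil
    have hj' : (j : ℕ) ≤ m*b - b := by simpa [Fin.le_def] using hj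
    by_cases h : i = l
    · rw [h, updateRow_self, Pi.single_eq_of_ne (fun h => by rw [h] at hj'; omega)]
    · have : (i : ℕ) ≠ l := fun h' => h (Fin.ext h')
      rw [updateRow_ne h]
      exact QP_eq_zero hm hb c (by omega) (by omega)

/-- The column of `adjugate Q_P` with index `b - 1`: for `k < n - b` the entry
equals the minor `μ(b-1, k)` and has total degree exactly `n - b`; the entry in row `n - b`
equals `det Q₃`; and the entries in rows `k` with `n - b < k < n` vanish. -/
theorem adjugate_QP_column_b_sub_one
    (m b : ℕ) (hm : 2 ≤ m) (hb : 1 ≤ b) (c : Fin (m*b) → ZMod 2) :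
    (∀ k : Fin (m*b), (k : ℕ) < m*b - b →
        (QP m b hm hb c).adjugate k
            ⟨b - 1, by have := Nat.mul_le_mul hm (le_refl b); omega⟩
          = minorQ (QP m b hm hb c)
              ⟨b - 1, by have := Nat.mul_le_mul hm (le_refl b); omega⟩ k ∧
        ((QP m b hm hb c).adjugate k
            ⟨b - 1, by have := Nat.mul_le_mul hm (le_refl b); omega⟩).totalDegree
          = m*b - b) ∧
    (QP m b hm hb c).adjugate
        ⟨m*b - b, by have := Nat.mul_le_mul hm (le_refl b); omega⟩
        ⟨b - 1, by have := Nat.mul_le_mul hm (le_refl b); omega⟩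
      = (Q3 m b hm hb c).det ∧
    (∀ k : Fin (m*b), m*b - b < (k : ℕ) →
        (QP m b hm hb c).adjugate k
            ⟨b - 1, by have := Nat.mul_le_mul hm (le_refl b); omega⟩ = 0) := by
  refine ⟨fun k hk => ⟨adjugate_eq_minorQ_of_charTwo _ _ _,
    totalDegree_adjugate_QP hm hb c k _ hk rfl⟩, ?_, fun k hk =>
    adjugate_QP_eq_zero hm hb c k _ hk rfl⟩
  exact adjugate_QP_eq_det hm hb c _ _ le_rfl rfl (fun i => ⟨b + i, by omega⟩)
    (fun j => ⟨j, by omega⟩) (fun _ => rfl) fun j => (if_pos j.isLt).symm
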